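/- Let N be a Nijenhuis operator on an associative conformal algebra A. Then A becomes a conformal NS-algebra under the λ-products a ≻_λ b = N(a)_λ b, a ≺_λ b = a_λ N(b), and a ∨_λ b = −N(a_λ b). -/

import Mathlib

open Polynomial

noncomputable section

/-!  Framework for associative conformal algebras over `ℂ[∂]`.

A `ℂ[∂]`-module is modelled as a module over `ℂ[X]` (with the variable `X`
playing the role of `∂`), together with a compatible `ℂ`-action.  A polynomial
`Σᵢ λ^i cᵢ` in a formal variable `λ` with coefficients in a module `V` is
recorded by its finitely supported family of coefficients `ℕ →₀ V`.  Identities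
between such polynomials are stated through their evaluations at every
`lam : ℂ`; over the infinite field `ℂ` this is equivalent to the corresponding
polynomial identities. -/

/-- Evaluation at `lam : ℂ` of a `V`-valued polynomial given by its coefficients. -/
def cev {V : Type*} [AddCommMonoid V] [Module ℂ V] (lam : ℂ) (p : ℕ →₀ V) : V :=
  p.sum fun i c => lam ^ i • c

/-- Substitution `μ ↦ -λ - ∂` in the polynomial `μ ↦ Σᵢ μ^i cᵢ`, where `∂ = X`
acts through the `ℂ[∂]`-module structure. -/
def csub {V : Type*} [AddCommMonoid V] [Module ℂ[X] V] (lam : ℂ) (p : ℕ →₀ V) : V :=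
  p.sum fun i c => ((-(C lam) - X) ^ i : ℂ[X]) • c

/-- A `ℂ`-bilinear conformal sesquilinear λ-product `A × B → M[λ]`, recorded by
the coefficient family `coeff a b : ℕ →₀ M` of the polynomial `a_λ b`. -/
structure ConfBilin (A B M : Type*)
    [AddCommGroup A] [Module ℂ A] [Module ℂ[X] A]
    [AddCommGroup B] [Module ℂ B] [Module ℂ[X] B]
    [AddCommGroup M] [Module ℂ M] [Module ℂ[X] M] where
  coeff : A → B → ℕ →₀ M
  add_left : ∀ a a' b, coeff (a + a') b = coeff a b + coeff a' b
  smul_left : ∀ (c : ℂ) a b, coeff (c • a) b = c • coeff a b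
  add_right : ∀ a b b', coeff a (b + b') = coeff a b + coeff a b'
  smul_right : ∀ (c : ℂ) a b, coeff a (c • b) = c • coeff a b
  /-- `(∂a)_λ b = -λ (a_λ b)` -/
  sesq_left : ∀ (lam : ℂ) (a : A) (b : B),
    cev lam (coeff ((X : ℂ[X]) • a) b) = (-lam) • cev lam (coeff a b)
  /-- `a_λ (∂b) = (∂ + λ) (a_λ b)` -/
  sesq_right : ∀ (lam : ℂ) (a : A) (b : B),
    cev lam (coeff a ((X : ℂ[X]) • b)) =
      (X : ℂ[X]) • cev lam (coeff a b) + lam • cev lam (coeff a b)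

namespace ConfBilin

variable {A B M : Type*}
  [AddCommGroup A] [Module ℂ A] [Module ℂ[X] A]
  [AddCommGroup B] [Module ℂ B] [Module ℂ[X] B]
  [AddCommGroup M] [Module ℂ M] [Module ℂ[X] M]

/-- `a_lam b` : the λ-product evaluated at `lam : ℂ`. -/
def mul (f : ConfBilin A B M) (lam : ℂ) (a : A) (b : B) : M := cev lam (f.coeff a b)

/-- `a_{-λ-∂} b` : the λ-product with `-λ-∂` substituted for the variable. -/
def mulNeg (f : ConfBilin A B M) (lam : ℂ) (a : A) (b : B) : M := csub lam (f.coeff a b)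

end ConfBilin

/-- An associative conformal algebra structure on the `ℂ[∂]`-module `A`. -/
structure AssocConfAlg (A : Type*)
    [AddCommGroup A] [Module ℂ A] [Module ℂ[X] A] extends ConfBilin A A A where
  /-- `(a_λ b)_{λ+μ} c = a_λ (b_μ c)` -/
  assoc : ∀ (lam mu : ℂ) (a b c : A),
    toConfBilin.mul (lam + mu) (toConfBilin.mul lam a b) c =
      toConfBilin.mul lam a (toConfBilin.mul mu b c)

namespace AssocConfAlg

variable {A : Type*} [AddCommGroup A] [Module ℂ A] [Module ℂ[X] A]

def mul (θ : AssocConfAlg A) : ℂ → A → A → A := θ.toConfBilin.mul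

def mulNeg (θ : AssocConfAlg A) : ℂ → A → A → A := θ.toConfBilin.mulNeg

end AssocConfAlg

/-- A conformal bimodule `M` over the associative conformal algebra `(A, θ)`,
with left action `l` and right action `r`. -/
structure ConfBimod {A : Type*} [AddCommGroup A] [Module ℂ A] [Module ℂ[X] A]
    (θ : AssocConfAlg A) (M : Type*)
    [AddCommGroup M] [Module ℂ M] [Module ℂ[X] M] where
  l : ConfBilin A M M
  r : ConfBilin M A M
  /-- `(a_λ b)_{λ+μ} m = a_λ (b_μ m)` -/
  assoc_ll : ∀ (lam mu : ℂ) (a b : A) (m : M),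
    l.mul (lam + mu) (θ.mul lam a b) m = l.mul lam a (l.mul mu b m)
  /-- `(m_λ a)_{λ+μ} b = m_λ (a_μ b)` -/
  assoc_rr : ∀ (lam mu : ℂ) (m : M) (a b : A),
    r.mul (lam + mu) (r.mul lam m a) b = r.mul lam m (θ.mul mu a b)
  /-- `(a_λ m)_{λ+μ} b = a_λ (m_μ b)` -/
  assoc_lr : ∀ (lam mu : ℂ) (a : A) (m : M) (b : A),
    r.mul (lam + mu) (l.mul lam a m) b = l.mul lam a (r.mul mu m b)

section Defs

variable {A M : Type*}
  [AddCommGroup A] [Module ℂ A] [Module ℂ[X] A]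
  [AddCommGroup M] [Module ℂ M] [Module ℂ[X] M]

/-- `T : M → A` is an `𝒪`-operator on `(A, θ)` with respect to the conformal
bimodule `ρ` : `T(m)_λ T(n) = T (T(m)_λ n + m_λ T(n))`. -/
def IsOOperator {θ : AssocConfAlg A} (ρ : ConfBimod θ M) (T : M → A) : Prop :=
  ∀ (lam : ℂ) (m n : M),
    θ.mul lam (T m) (T n) = T (ρ.l.mul lam (T m) n + ρ.r.mul lam m (T n))

/-- `N : A → A` is a Nijenhuis operator :
`N(a)_λ N(b) = N (N(a)_λ b + a_λ N(b) - N(a_λ b))`. -/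
def IsNijenhuis (θ : AssocConfAlg A) (N : A → A) : Prop :=
  ∀ (lam : ℂ) (a b : A),
    θ.mul lam (N a) (N b) =
      N (θ.mul lam (N a) b + θ.mul lam a (N b) - N (θ.mul lam a b))

/-- `T : A → A` is a Rota-Baxter operator of weight `q`. -/
def IsRotaBaxterWt (θ : AssocConfAlg A) (q : ℂ) (T : A → A) : Prop :=
  ∀ (lam : ℂ) (a b : A),
    θ.mul lam (T a) (T b) =
      T (θ.mul lam (T a) b + θ.mul lam a (T b) + q • θ.mul lam a b)

/-- The Hochschild 2-cocycle identity for an `M`-valued λ-bilinear map `ψ` on `A`. -/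
def IsTwoCocycleFun {θ : AssocConfAlg A} (ρ : ConfBimod θ M)
    (ψ : ℂ → A → A → M) : Prop :=
  ∀ (lam mu : ℂ) (a b c : A),
    ρ.l.mul lam a (ψ mu b c) - ψ (lam + mu) (θ.mul lam a b) c
      + ψ lam a (θ.mul mu b c) - ρ.r.mul (lam + mu) (ψ lam a b) c = 0

/-- `φ` is a 2-cocycle in `C²(A, M)`. -/
def IsTwoCocycle {θ : AssocConfAlg A} (ρ : ConfBimod θ M)
    (φ : ConfBilin A A M) : Prop :=
  IsTwoCocycleFun ρ φ.mul

/-- `T : M → A` is a `φ`-twisted Rota-Baxter operator :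
`T(m)_λ T(n) = T (T(m)_λ n + m_λ T(n) + φ_λ(T(m), T(n)))`. -/
def IsTwistedRB {θ : AssocConfAlg A} (ρ : ConfBimod θ M) (φ : ConfBilin A A M)
    (T : M → A) : Prop :=
  ∀ (lam : ℂ) (m n : M),
    θ.mul lam (T m) (T n) =
      T (ρ.l.mul lam (T m) n + ρ.r.mul lam m (T n) + φ.mul lam (T m) (T n))

/-- The λ-product of the semidirect product `A ⊕₀ M`. -/
def sdMul {θ : AssocConfAlg A} (ρ : ConfBimod θ M) (lam : ℂ) (x y : A × M) : A × M :=
  (θ.mul lam x.1 y.1, ρ.l.mul lam x.1 y.2 + ρ.r.mul lam x.2 y.1)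

/-- The λ-product of the twisted semidirect product `A ⊕_ψ M`. -/
def sdMulTw {θ : AssocConfAlg A} (ρ : ConfBimod θ M) (ψ : ℂ → A → A → M)
    (lam : ℂ) (x y : A × M) : A × M :=
  (θ.mul lam x.1 y.1, ρ.l.mul lam x.1 y.2 + ρ.r.mul lam x.2 y.1 + ψ lam x.1 y.1)

/-- The lift `T̂(a, m) = (T(m), 0)` of a map `T : M → A` to `A ⊕ M`. -/
def liftMap (T : M → A) (x : A × M) : A × M := (T x.2, 0)

/-- The λ-product `m ⋆_λ n = T(m)_λ n + m_λ T(n)` on `M` induced by an `𝒪`-operator. -/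
def oStar {θ : AssocConfAlg A} (ρ : ConfBimod θ M) (T : M → A)
    (lam : ℂ) (m n : M) : M :=
  ρ.l.mul lam (T m) n + ρ.r.mul lam m (T n)

/-- The left λ-action `m ·_λ a = T(m)_λ a - T(m_λ a)` of `M_ass` on `A`. -/
def oDotL {θ : AssocConfAlg A} (ρ : ConfBimod θ M) (T : M → A)
    (lam : ℂ) (m : M) (a : A) : A :=
  θ.mul lam (T m) a - T (ρ.r.mul lam m a)

/-- The right λ-action `a ·_λ m = a_λ T(m) - T(a_λ m)` of `M_ass` on `A`. -/
def oDotR {θ : AssocConfAlg A} (ρ : ConfBimod θ M) (T : M → A)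
    (lam : ℂ) (a : A) (m : M) : A :=
  θ.mul lam a (T m) - T (ρ.l.mul lam a m)

/-- `m ⋆^φ_λ n = T(m)_λ n + m_λ T(n) + φ_λ(T(m), T(n))`. -/
def twStar {θ : AssocConfAlg A} (ρ : ConfBimod θ M) (φ : ConfBilin A A M)
    (T : M → A) (lam : ℂ) (m n : M) : M :=
  ρ.l.mul lam (T m) n + ρ.r.mul lam m (T n) + φ.mul lam (T m) (T n)

/-- `m ·^φ_λ a = T(m)_λ a - T (m_λ a + φ_λ(T(m), a))`. -/
def twDotL {θ : AssocConfAlg A} (ρ : ConfBimod θ M) (φ : ConfBilin A A M)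
    (T : M → A) (lam : ℂ) (m : M) (a : A) : A :=
  θ.mul lam (T m) a - T (ρ.r.mul lam m a + φ.mul lam (T m) a)

/-- `a ·^φ_λ m = a_λ T(m) - T (a_λ m + φ_λ(a, T(m)))`. -/
def twDotR {θ : AssocConfAlg A} (ρ : ConfBimod θ M) (φ : ConfBilin A A M)
    (T : M → A) (lam : ℂ) (a : A) (m : M) : A :=
  θ.mul lam a (T m) - T (ρ.l.mul lam a m + φ.mul lam a (T m))

/-- The map `(a, m) ↦ (a, m - h(a))` on `A ⊕ M`. -/
def shiftMap (h : A → M) (p : A × M) : A × M := (p.1, p.2 - h p.1)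

/-- The deformed λ-product `a ∘^N_λ b = N(a)_λ b + a_λ N(b) - N(a_λ b)`. -/
def nijProd (θ : AssocConfAlg A) (N : A → A) (lam : ℂ) (a b : A) : A :=
  θ.mul lam (N a) b + θ.mul lam a (N b) - N (θ.mul lam a b)

end Defs

/-- A dendriform conformal algebra. -/
structure DendriformConfAlg (E : Type*)
    [AddCommGroup E] [Module ℂ E] [Module ℂ[X] E] where
  succ : ConfBilin E E E
  prec : ConfBilin E E E
  dend1 : ∀ (lam mu : ℂ) (a b c : E),
    succ.mul lam a (succ.mul mu b c) =
      succ.mul (lam + mu) (succ.mul lam a b + prec.mul lam a b) c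
  dend2 : ∀ (lam mu : ℂ) (a b c : E),
    prec.mul (lam + mu) (prec.mul lam a b) c =
      prec.mul lam a (succ.mul mu b c + prec.mul mu b c)
  dend3 : ∀ (lam mu : ℂ) (a b c : E),
    prec.mul (lam + mu) (succ.mul lam a b) c = succ.mul lam a (prec.mul mu b c)

/-- The product `a ∘_λ b = a ≻_λ b - b ≺_{-λ-∂} a` of a dendriform conformal algebra. -/
def dendComp {E : Type*} [AddCommGroup E] [Module ℂ E] [Module ℂ[X] E]
    (D : DendriformConfAlg E) (lam : ℂ) (a b : E) : E :=
  D.succ.mul lam a b - D.prec.mulNeg lam b a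

/-- A conformal NS-algebra. -/
structure NSConfAlg (E : Type*)
    [AddCommGroup E] [Module ℂ E] [Module ℂ[X] E] where
  succ : ConfBilin E E E
  prec : ConfBilin E E E
  vee : ConfBilin E E E
  ns1 : ∀ (lam mu : ℂ) (x y z : E),
    succ.mul lam x (succ.mul mu y z) =
      succ.mul (lam + mu) (succ.mul lam x y + prec.mul lam x y + vee.mul lam x y) z
  ns2 : ∀ (lam mu : ℂ) (x y z : E),
    prec.mul lam x (succ.mul mu y z + prec.mul mu y z + vee.mul mu y z) =
      prec.mul (lam + mu) (prec.mul lam x y) z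
  ns3 : ∀ (lam mu : ℂ) (x y z : E),
    succ.mul lam x (prec.mul mu y z) = prec.mul (lam + mu) (succ.mul lam x y) z
  ns4 : ∀ (lam mu : ℂ) (x y z : E),
    succ.mul lam x (vee.mul mu y z)
        - vee.mul (lam + mu) (succ.mul lam x y + prec.mul lam x y + vee.mul lam x y) z =
      prec.mul (lam + mu) (vee.mul lam x y) z
        - vee.mul lam x (succ.mul mu y z + prec.mul mu y z + vee.mul mu y z)

/-- `x ×_λ y = x ≻_λ y + x ≺_λ y + x ∨_λ y` in a conformal NS-algebra. -/
def nsTimes {E : Type*} [AddCommGroup E] [Module ℂ E] [Module ℂ[X] E]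
    (NS : NSConfAlg E) (lam : ℂ) (x y : E) : E :=
  NS.succ.mul lam x y + NS.prec.mul lam x y + NS.vee.mul lam x y

theorem cev_add' {V : Type*} [AddCommGroup V] [Module ℂ V] (lam : ℂ) (p q : ℕ →₀ V) :
    cev lam (p + q) = cev lam p + cev lam q := by
  unfold cev
  exact Finsupp.sum_add_index' (by simp) (by simp)

theorem cev_map' {V : Type*} [AddCommGroup V] [Module ℂ V] (lam : ℂ) (f : V →ₗ[ℂ] V)
    (p : ℕ →₀ V) : cev lam (Finsupp.mapRange f (map_zero f) p) = f (cev lam p) := by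
  unfold cev
  rw [Finsupp.sum_mapRange_index (by simp), map_finsuppSum]
  simp

/-- a Nijenhuis operator `N` on an associative conformal algebra
`A` makes `A` a conformal NS-algebra via `a ≻_λ b = N(a)_λ b`,
`a ≺_λ b = a_λ N(b)` and `a ∨_λ b = -N(a_λ b)`. -/
theorem stmt14 {A : Type*}
    [AddCommGroup A] [Module ℂ A] [Module ℂ[X] A] [IsScalarTower ℂ ℂ[X] A]
    (θ : AssocConfAlg A) (N : A →ₗ[ℂ[X]] A) (hN : IsNijenhuis θ ⇑N) :
    ∃ NS : NSConfAlg A,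
      (∀ (lam : ℂ) (a b : A), NS.succ.mul lam a b = θ.mul lam (N a) b) ∧
      (∀ (lam : ℂ) (a b : A), NS.prec.mul lam a b = θ.mul lam a (N b)) ∧
      (∀ (lam : ℂ) (a b : A), NS.vee.mul lam a b = -N (θ.mul lam a b)) := by
  let f : A →ₗ[ℂ] A := -(N.restrictScalars ℂ)
  have hf : ∀ a, f a = -N a := fun a => rfl
  have hsm : ∀ (c : ℂ) (a : A), N (c • a) = c • N a := fun c a => N.map_smul_of_tower c a
  let S : ConfBilin A A A :=
    { coeff := fun a b => θ.coeff (N a) b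
      add_left := fun a a' b => by rw [map_add, θ.add_left]
      smul_left := fun c a b => by rw [hsm, θ.smul_left]
      add_right := fun a b b' => θ.add_right _ _ _
      smul_right := fun c a b => θ.smul_right _ _ _
      sesq_left := fun lam a b => by rw [map_smul, θ.sesq_left]
      sesq_right := fun lam a b => θ.sesq_right _ _ _ }
  let P : ConfBilin A A A :=
    { coeff := fun a b => θ.coeff a (N b)
      add_left := fun a a' b => θ.add_left _ _ _
      smul_left := fun c a b => θ.smul_left _ _ _
      add_right := fun a b b' => by rw [map_add, θ.add_right]
      smul_right := fun c a b => by rw [hsm, θ.smul_right]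
      sesq_left := fun lam a b => θ.sesq_left _ _ _
      sesq_right := fun lam a b => by rw [map_smul, θ.sesq_right] }
  let W : ConfBilin A A A :=
    { coeff := fun a b => Finsupp.mapRange f (map_zero f) (θ.coeff a b)
      add_left := fun a a' b => by
        rw [θ.add_left, Finsupp.mapRange_add (map_add f)]
      smul_left := fun c a b => by
        rw [θ.smul_left]; ext i; simp
      add_right := fun a b b' => by
        rw [θ.add_right, Finsupp.mapRange_add (map_add f)]
      smul_right := fun c a b => by
        rw [θ.smul_right]; ext i; simp
      sesq_left := fun lam a b => by
        rw [cev_map', cev_map', θ.sesq_left, map_smul]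
      sesq_right := fun lam a b => by
        rw [cev_map', cev_map', θ.sesq_right, hf, hf, map_add, hsm, N.map_smul, smul_neg, smul_neg, neg_add] }
  have hS : ∀ lam a b, S.mul lam a b = θ.mul lam (N a) b := fun _ _ _ => rfl
  have hP : ∀ lam a b, P.mul lam a b = θ.mul lam a (N b) := fun _ _ _ => rfl
  have hW : ∀ lam a b, W.mul lam a b = -N (θ.mul lam a b) := fun lam a b =>
    cev_map' lam f (θ.coeff a b)
  have as : ∀ (lam mu : ℂ) (a b c : A), θ.mul (lam + mu) (θ.mul lam a b) c =
      θ.mul lam a (θ.mul mu b c) := θ.assoc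
  have al : ∀ lam a a' b, θ.mul lam (a + a') b = θ.mul lam a b + θ.mul lam a' b := by
    intro lam a a' b
    change cev _ _ = cev _ _ + cev _ _
    rw [θ.add_left, cev_add']
  have ar : ∀ lam a b b', θ.mul lam a (b + b') = θ.mul lam a b + θ.mul lam a b' := by
    intro lam a b b'
    change cev _ _ = cev _ _ + cev _ _
    rw [θ.add_right, cev_add']
  have nl : ∀ lam a b, θ.mul lam (-a) b = -θ.mul lam a b := fun lam a b =>
    map_neg (AddMonoidHom.mk' (fun a => θ.mul lam a b) (fun a a' => al lam a a' b)) a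
  have nr : ∀ lam a b, θ.mul lam a (-b) = -θ.mul lam a b := fun lam a b =>
    map_neg (AddMonoidHom.mk' (fun b => θ.mul lam a b) (fun b b' => ar lam a b b')) b
  have hN' : ∀ lam a b, N (θ.mul lam (N a) b + θ.mul lam a (N b) + -N (θ.mul lam a b)) =
      θ.mul lam (N a) (N b) := fun lam a b => by
    rw [← sub_eq_add_neg]; exact (hN lam a b).symm
  refine ⟨⟨S, P, W, ?_, ?_, ?_, ?_⟩, hS, hP, hW⟩
  · intro lam mu x y z
    simp only [hS, hP, hW]
    rw [hN', as]
  · intro lam mu x y z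
    simp only [hS, hP, hW]
    rw [hN', as]
  · intro lam mu x y z
    simp only [hS, hP]
    rw [as]
  · intro lam mu x y z
    simp only [hS, hP, hW]
    have h1 := hN' lam x (θ.mul mu y z)
    have h2 := hN' (lam + mu) (θ.mul lam x y) z
    simp only [al, ar, nl, nr, as, map_add, map_neg] at h1 h2 ⊢
    rw [← h1, ← h2]
    abel
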